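/- Fix ν ∈ (0,1), λ > 0, Δx > 0 and y_0 ∈ ℝ, and let (y_j)_{j≥0} solve the eigenvalue scheme. Then the scheme is unconditionally stable: |y_k| ≤ ((2+ν)/(2−ν))·|y_0| for every integer k ≥ 1. -/

import Mathlib

open Real Finset

noncomputable section

/-- α₀ = (ν+2)/(2^ν·Γ(3−ν)). -/
def alpha0 (ν : ℝ) : ℝ := (ν + 2) / ((2 : ℝ) ^ ν * Real.Gamma (3 - ν))

/-- θ = 2ν/(2+ν). -/
def theta (ν : ℝ) : ℝ := 2 * ν / (2 + ν)

/-- The coefficients D̄_k^(m). -/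
def Dbar (ν : ℝ) (m k : ℕ) : ℝ :=
  if k = 0 then
    (1 / Real.Gamma (3 - ν)) *
      (-((2 - ν) / 2) * ((2 * m : ℝ) ^ (1 - ν) + 3 * ((2 * m : ℝ) + 2) ^ (1 - ν))
        - (2 * m : ℝ) ^ (2 - ν) + ((2 * m : ℝ) + 2) ^ (2 - ν))
  else if k % 2 = 0 then
    (1 / Real.Gamma (3 - ν)) *
      (-((2 - ν) / 2) * (((2 * m : ℝ) - 2 * (k / 2 : ℕ)) ^ (1 - ν)
          + 6 * ((2 * m : ℝ) - 2 * (k / 2 : ℕ) + 2) ^ (1 - ν)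
          + ((2 * m : ℝ) - 2 * (k / 2 : ℕ) + 4) ^ (1 - ν))
        - ((2 * m : ℝ) - 2 * (k / 2 : ℕ)) ^ (2 - ν)
        + ((2 * m : ℝ) - 2 * (k / 2 : ℕ) + 4) ^ (2 - ν))
  else
    (2 / Real.Gamma (3 - ν)) *
      ((2 - ν) * (((2 * m : ℝ) - 2 * (k / 2 : ℕ)) ^ (1 - ν)
          + ((2 * m : ℝ) - 2 * (k / 2 : ℕ) + 2) ^ (1 - ν))
        + ((2 * m : ℝ) - 2 * (k / 2 : ℕ)) ^ (2 - ν)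
        - ((2 * m : ℝ) - 2 * (k / 2 : ℕ) + 2) ^ (2 - ν))

/-- The coefficients D_k^(m); for k ≥ 3 one has D_k^(m) = D̄_{k+1}^(m). -/
def Dco (ν : ℝ) (m k : ℕ) : ℝ :=
  if k = 0 then
    (1 / Real.Gamma (3 - ν)) *
      (((2 - ν) / 2) * ((2 * m : ℝ) ^ (1 - ν) - 3 * ((2 * m : ℝ) + 1) ^ (1 - ν))
        - (2 * m : ℝ) ^ (2 - ν) + ((2 * m : ℝ) + 1) ^ (2 - ν))
  else if k = 1 then
    (1 / Real.Gamma (3 - ν)) *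
      (-((2 - ν) / 2) * (((2 * m : ℝ) - 2) ^ (1 - ν) + 3 * (2 * m : ℝ) ^ (1 - ν)
          - 4 * ((2 * m : ℝ) + 1) ^ (1 - ν))
        - ((2 * m : ℝ) - 2) ^ (2 - ν) + 3 * (2 * m : ℝ) ^ (2 - ν)
        - 2 * ((2 * m : ℝ) + 1) ^ (2 - ν))
  else if k = 2 then
    (1 / Real.Gamma (3 - ν)) *
      (((2 - ν) / 2) * (4 * ((2 * m : ℝ) - 2) ^ (1 - ν) + 3 * (2 * m : ℝ) ^ (1 - ν)
          - ((2 * m : ℝ) + 1) ^ (1 - ν))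
        + 2 * ((2 * m : ℝ) - 2) ^ (2 - ν) - 3 * (2 * m : ℝ) ^ (2 - ν)
        + ((2 * m : ℝ) + 1) ^ (2 - ν))
  else Dbar ν m (k + 1)

/-- The scheme coefficients d_k^j. -/
def dco (ν : ℝ) (j k : ℕ) : ℝ :=
  if j % 2 = 1 then -Dco ν (j / 2) k / alpha0 ν
  else -Dbar ν (j / 2 - 1) k / alpha0 ν

/-- The transformed coefficients d̄_k^j. -/
def dbarco (ν : ℝ) (j k : ℕ) : ℝ :=
  if k = j then -1
  else if j = 3 then
    if k = 2 then dco ν 3 2 - theta ν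
    else if k = 1 then theta ν * (dco ν 3 2 - theta ν) + dco ν 3 1
    else theta ν * (theta ν * (dco ν 3 2 - theta ν) + dco ν 3 1) + dco ν 3 0
  else
    theta ν ^ (j - k) + ∑ k' ∈ Finset.Icc k (j - 2), dco ν j k' * theta ν ^ (k' - k)

/-- The coefficients B̄_i^n: B̄_0^n = Δx^{−ν}α₀ and
    B̄_{n−k}^n = B̄_{n−k−1}^n − Δx^{−ν}·α₀·d̄_k^n for k = n−1,…,1. -/
def Bbar (ν Δx : ℝ) (n : ℕ) : ℕ → ℝ
  | 0 => Δx ^ (-ν) * alpha0 ν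
  | i + 1 => Bbar ν Δx n i - Δx ^ (-ν) * alpha0 ν * dbarco ν n (n - (i + 1))

/-- The complementary discrete kernels P_j^n. -/
def Pker (ν Δx : ℝ) (n : ℕ) : ℕ → ℝ
  | 0 => 1 / Bbar ν Δx n 0
  | j + 1 =>
    if n ≤ j + 3 then 0
    else (1 / Bbar ν Δx (n - (j + 1)) 0) *
      ∑ k ∈ (Finset.range (j + 1)).attach,
        (Bbar ν Δx (n - k.1) (j - k.1) - Bbar ν Δx (n - k.1) (j + 1 - k.1)) * Pker ν Δx n k.1
  decreasing_by
    have := Finset.mem_range.mp k.2; omega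

/-- D̂_0, D̂_1, D̂_2, D̃_0, D̃_1, D̃_2 : first/second-step coefficients. -/
def Dhat0 (ν : ℝ) : ℝ := (3 * ν - 4) / (2 * Real.Gamma (3 - ν))
def Dhat1 (ν : ℝ) : ℝ := 2 * (1 - ν) / Real.Gamma (3 - ν)
def Dhat2 (ν : ℝ) : ℝ := ν / (2 * Real.Gamma (3 - ν))
def Dtil0 (ν : ℝ) : ℝ := (3 * ν - 2) / ((2 : ℝ) ^ ν * Real.Gamma (3 - ν))
def Dtil1 (ν : ℝ) : ℝ := -(4 * ν) / ((2 : ℝ) ^ ν * Real.Gamma (3 - ν))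
def Dtil2 (ν : ℝ) : ℝ := (ν + 2) / ((2 : ℝ) ^ ν * Real.Gamma (3 - ν))

/-- The Caputo fractional derivative of order ν. -/
def caputo (ν : ℝ) (y : ℝ → ℝ) (x : ℝ) : ℝ :=
  (1 / Real.Gamma (1 - ν)) * ∫ s in (0:ℝ)..x, (x - s) ^ (-ν) * deriv y s

/-- The discrete Caputo derivative of a function y at the grid point x_j = jΔx. -/
def discCaputo (ν Δx : ℝ) (y : ℝ → ℝ) (j : ℕ) : ℝ :=
  if j = 1 then
    Δx ^ (-ν) * (Dhat0 ν * y 0 + Dhat1 ν * y Δx + Dhat2 ν * y (2 * Δx))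
  else if j = 2 then
    Δx ^ (-ν) * (Dtil0 ν * y 0 + Dtil1 ν * y Δx + Dtil2 ν * y (2 * Δx))
  else if j % 2 = 1 then
    Δx ^ (-ν) * ((∑ k ∈ Finset.range j, Dco ν (j / 2) k * y ((k : ℝ) * Δx))
      + alpha0 ν * y ((j : ℝ) * Δx))
  else
    Δx ^ (-ν) * ((∑ k ∈ Finset.range j, Dbar ν (j / 2 - 1) k * y ((k : ℝ) * Δx))
      + alpha0 ν * y ((j : ℝ) * Δx))

/-- Truncation error r_j(Δx). -/
def trunc (ν Δx : ℝ) (y : ℝ → ℝ) (j : ℕ) : ℝ :=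
  caputo ν y ((j : ℝ) * Δx) - discCaputo ν Δx y j

/-- The Mittag–Leffler function E_ν(z) = Σ_{k≥0} z^k/Γ(1+kν). -/
def mlE (ν z : ℝ) : ℝ := ∑' k : ℕ, z ^ k / Real.Gamma (1 + (k : ℝ) * ν)

end

/-- Bernoulli's inequality as a tangent-line bound for the concave power `t ↦ t ^ p`. -/
lemma rpow_le_tangent {p x t : ℝ} (hp0 : 0 ≤ p) (hp1 : p ≤ 1) (hx : 0 < x) (ht : 0 ≤ t) :
    t ^ p ≤ x ^ p + p * x ^ (p - 1) * (t - x) := by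
  have h := _root_.rpow_one_add_le_one_add_mul_self (s := t / x - 1) (p := p)
    (by have : 0 ≤ t / x := by positivity
        linarith) hp0 hp1
  have e : 1 + (t / x - 1) = t / x := by ring
  rw [e, Real.div_rpow ht hx.le, div_le_iff₀ (Real.rpow_pos_of_pos hx p)] at h
  refine h.trans (le_of_eq ?_)
  rw [Real.rpow_sub_one hx.ne']
  field_simp

/-- Tangent-line bound for `t ↦ t ^ (-ν)`, read as a concave function of `1 / t`. -/
lemma rpow_neg_le_tangent_inv {ν y t : ℝ} (hν0 : 0 ≤ ν) (hν1 : ν ≤ 1) (hy : 0 < y) (ht : 0 < t) :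
    t ^ (-ν) ≤ y ^ (-ν) + ν * y ^ (1 - ν) * (t⁻¹ - y⁻¹) := by
  have h := rpow_le_tangent (p := ν) (x := y⁻¹) (t := t⁻¹) hν0 hν1 (by positivity) (by positivity)
  rwa [Real.inv_rpow ht.le, ← Real.rpow_neg ht.le, Real.inv_rpow hy.le, ← Real.rpow_neg hy.le,
    Real.inv_rpow hy.le, ← Real.rpow_neg hy.le, neg_sub] at h

/-- Tangent-line bound for the convex function `t ↦ t ^ (-ν)`. -/
lemma tangent_le_rpow_neg {ν x t : ℝ} (hν0 : 0 < ν) (hx : 0 < x) (ht : 0 < t) :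
    x ^ (-ν) - ν * x ^ (-ν - 1) * (t - x) ≤ t ^ (-ν) := by
  have hr : 0 < t / x := by positivity
  have h : 1 + -ν * (t / x - 1) ≤ (t / x) ^ (-ν) := by
    rw [Real.rpow_def_of_pos hr]
    have h1 := Real.add_one_le_exp (Real.log (t / x) * -ν)
    have h2 := mul_le_mul_of_nonneg_left (Real.log_le_sub_one_of_pos hr) hν0.le
    linarith
  rw [Real.div_rpow ht.le hx.le, le_div_iff₀ (Real.rpow_pos_of_pos hx _)] at h
  refine le_trans (le_of_eq ?_) h
  rw [Real.rpow_sub_one hx.ne']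
  field_simp
  ring

lemma nonpos_of_hasDerivAt_nonpos {φ φ' : ℝ → ℝ} {b : ℝ} (hb : 0 ≤ b) (h0 : φ 0 = 0)
    (hd : ∀ u ∈ Set.Icc 0 b, HasDerivAt φ (φ' u) u) (hn : ∀ u ∈ Set.Icc 0 b, φ' u ≤ 0) :
    φ b ≤ 0 := by
  have h : AntitoneOn φ (Set.Icc 0 b) := by
    apply antitoneOn_of_deriv_nonpos (convex_Icc 0 b)
      (fun u hu => (hd u hu).continuousAt.continuousWithinAt)
    · intro u hu
      exact (hd u (interior_subset hu)).differentiableAt.differentiableWithinAt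
    · intro u hu
      rw [(hd u (interior_subset hu)).deriv]
      exact hn u (interior_subset hu)
  have := h (Set.left_mem_Icc.2 hb) (Set.right_mem_Icc.2 hb) hb
  linarith

lemma hasDerivAt_rpow_affine {p x r u : ℝ} (h : 0 < x + r * u) :
    HasDerivAt (fun u => (x + r * u) ^ p) (p * r * (x + r * u) ^ (p - 1)) u := by
  have h1 : HasDerivAt (fun u : ℝ => x + r * u) r u := by
    simpa using ((hasDerivAt_id u).const_mul r).const_add x
  convert h1.rpow_const (p := p) (Or.inl h.ne') using 1
  ring

/-- Midpoint-rule bound for the integral of the convex function `(1 - ν) t ^ (-ν)`. -/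
lemma midpoint_le_rpow_sub {ν x u : ℝ} (hν0 : 0 < ν) (hν1 : ν < 1) (hu : 0 ≤ u) (hux : u < x) :
    2 * u * ((1 - ν) * x ^ (-ν)) ≤ (x + u) ^ (1 - ν) - (x - u) ^ (1 - ν) := by
  have key := nonpos_of_hasDerivAt_nonpos
    (φ := fun u => 2 * ((1 - ν) * x ^ (-ν)) * u - (x + 1 * u) ^ (1 - ν) + (x + (-1) * u) ^ (1 - ν))
    (φ' := fun u => 2 * ((1 - ν) * x ^ (-ν)) * 1 - (1 - ν) * 1 * (x + 1 * u) ^ (1 - ν - 1)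
      + (1 - ν) * (-1) * (x + (-1) * u) ^ (1 - ν - 1)) hu (by simp) ?_ ?_
  · have e : x + -1 * u = x - u := by ring
    simp only [one_mul, e] at key
    linarith
  · rintro v ⟨hv0, hv1⟩
    exact (((hasDerivAt_id v).const_mul _).sub (hasDerivAt_rpow_affine (by linarith))).add
      (hasDerivAt_rpow_affine (by linarith))
  · rintro v ⟨hv0, hv1⟩
    have h1 := tangent_le_rpow_neg (x := x) (t := x + 1 * v) hν0 (by linarith) (by linarith)
    have h2 := tangent_le_rpow_neg (x := x) (t := x + (-1) * v) hν0 (by linarith) (by linarith)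
    have e : (1 - ν - 1 : ℝ) = -ν := by ring
    simp only [e]
    have h3 : 2 * x ^ (-ν) ≤ (x + 1 * v) ^ (-ν) + (x + (-1) * v) ^ (-ν) := by linarith
    nlinarith [mul_le_mul_of_nonneg_left h3 (by linarith : 0 ≤ 1 - ν)]

/-- Trapezoidal-rule bound for the integral of the convex function `(1 - ν) t ^ (-ν)`. -/
lemma rpow_sub_le_trapezoid {ν x u : ℝ} (hν0 : 0 < ν) (hν1 : ν < 1) (hx : 0 < x) (hu : 0 ≤ u) :
    (x + u) ^ (1 - ν) - x ^ (1 - ν) ≤ u / 2 * ((1 - ν) * x ^ (-ν) + (1 - ν) * (x + u) ^ (-ν)) := by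
  have key := nonpos_of_hasDerivAt_nonpos
    (φ := fun u => (x + 1 * u) ^ (1 - ν) - x ^ (1 - ν)
      - (1 - ν) / 2 * (u * (x ^ (-ν) + (x + 1 * u) ^ (-ν))))
    (φ' := fun u => (1 - ν) * 1 * (x + 1 * u) ^ (1 - ν - 1)
      - (1 - ν) / 2 * (1 * (x ^ (-ν) + (x + 1 * u) ^ (-ν))
        + u * (-ν * 1 * (x + 1 * u) ^ (-ν - 1)))) hu (by simp) ?_ ?_
  · simp only [one_mul] at key
    linarith
  · rintro v ⟨hv0, hv1⟩
    exact ((hasDerivAt_rpow_affine (by linarith)).sub_const _).sub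
      (((hasDerivAt_id v).mul ((hasDerivAt_rpow_affine (by linarith)).const_add _)).const_mul _)
  · rintro v ⟨hv0, hv1⟩
    have h1 := tangent_le_rpow_neg (x := x + 1 * v) (t := x) hν0 (by linarith) (by linarith)
    have e : (1 - ν - 1 : ℝ) = -ν := by ring
    simp only [e]
    have := mul_le_mul_of_nonneg_left h1 (by linarith : 0 ≤ (1 - ν) / 2)
    linarith

/-- The trapezoidal rule underestimates the integral of `(2 - ν) t ^ (1 - ν)`. -/
lemma trapezoid_le {ν s : ℝ} (hν0 : 0 < ν) (hν1 : ν < 1) (hs : 0 < s) :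
    (2 - ν) * (s ^ (1 - ν) + (s + 2) ^ (1 - ν)) + s ^ (2 - ν) - (s + 2) ^ (2 - ν) ≤ 0 := by
  have key := nonpos_of_hasDerivAt_nonpos (b := 2)
    (φ := fun u => (2 - ν) / 2 * (u * (s ^ (1 - ν) + (s + 1 * u) ^ (1 - ν))) + s ^ (2 - ν)
      - (s + 1 * u) ^ (2 - ν))
    (φ' := fun u => (2 - ν) / 2 * (1 * (s ^ (1 - ν) + (s + 1 * u) ^ (1 - ν))
      + u * ((1 - ν) * 1 * (s + 1 * u) ^ (1 - ν - 1)))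
      - (2 - ν) * 1 * (s + 1 * u) ^ (2 - ν - 1)) (by norm_num) (by simp) ?_ ?_
  · simp only [one_mul] at key
    linarith
  · rintro v ⟨hv0, hv1⟩
    exact ((((hasDerivAt_id v).mul ((hasDerivAt_rpow_affine (by linarith)).const_add _)).const_mul
      _).add_const _).sub (hasDerivAt_rpow_affine (by linarith))
  · rintro v ⟨hv0, hv1⟩
    have h1 := rpow_le_tangent (p := 1 - ν) (x := s + 1 * v) (t := s) (by linarith) (by linarith)
      (by linarith) hs.le
    have e : (2 - ν - 1 : ℝ) = 1 - ν := by ring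
    simp only [e]
    have := mul_le_mul_of_nonneg_left h1 (by linarith : 0 ≤ (2 - ν) / 2)
    linarith

lemma three_panel_le {ν s : ℝ} (hν0 : 0 < ν) (hν1 : ν < 1) (hs : 2 ≤ s) :
    -((2 - ν) / 2) * (s ^ (1 - ν) + 6 * (s + 2) ^ (1 - ν) + (s + 4) ^ (1 - ν))
      - s ^ (2 - ν) + (s + 4) ^ (2 - ν) ≤ 0 := by
  obtain ⟨x, rfl⟩ : ∃ x, s = x - 2 := ⟨s + 2, by ring⟩
  have hx : 4 ≤ x := by linarith
  have key := nonpos_of_hasDerivAt_nonpos (b := 2)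
    (φ := fun u => -((2 - ν) / 4) * (u * ((x + (-1) * u) ^ (1 - ν) + 6 * x ^ (1 - ν)
      + (x + 1 * u) ^ (1 - ν))) - (x + (-1) * u) ^ (2 - ν) + (x + 1 * u) ^ (2 - ν))
    (φ' := fun u => -((2 - ν) / 4) * (1 * ((x + (-1) * u) ^ (1 - ν) + 6 * x ^ (1 - ν)
      + (x + 1 * u) ^ (1 - ν)) + u * ((1 - ν) * (-1) * (x + (-1) * u) ^ (1 - ν - 1)
      + (1 - ν) * 1 * (x + 1 * u) ^ (1 - ν - 1)))
      - (2 - ν) * (-1) * (x + (-1) * u) ^ (2 - ν - 1)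
      + (2 - ν) * 1 * (x + 1 * u) ^ (2 - ν - 1)) (by norm_num) (by simp) ?_ ?_
  · have e1 : x + -1 * 2 = x - 2 := by ring
    have e2 : x - 2 + 4 = x + 1 * 2 := by ring
    have e3 : x - 2 + 2 = x := by ring
    rw [e1] at key
    rw [e2, e3]
    linarith
  · rintro v ⟨hv0, hv1⟩
    exact ((((hasDerivAt_id v).mul (((hasDerivAt_rpow_affine (by linarith)).add_const _).add
      (hasDerivAt_rpow_affine (by linarith)))).const_mul _).sub
      (hasDerivAt_rpow_affine (by linarith))).add (hasDerivAt_rpow_affine (by linarith))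
  · rintro v ⟨hv0, hv1⟩
    have e : (2 - ν - 1 : ℝ) = 1 - ν := by ring
    have e' : (1 - ν - 1 : ℝ) = -ν := by ring
    have e1 : x + -1 * v = x - v := by ring
    simp only [e, e', e1, one_mul]
    have hm := midpoint_le_rpow_sub (x := x - v / 2) (u := v / 2) hν0 hν1 (by linarith)
      (by linarith)
    rw [sub_add_cancel, sub_sub, add_halves] at hm
    have ht := rpow_sub_le_trapezoid (x := x) (u := v) hν0 hν1 (by linarith) hv0
    have hy : 0 < x - v / 2 := by linarith
    have i1 := rpow_neg_le_tangent_inv (t := x - v) hν0.le hν1.le hy (by linarith)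
    have i2 := rpow_neg_le_tangent_inv (t := x) hν0.le hν1.le hy (by linarith)
    have i3 := rpow_neg_le_tangent_inv (t := x + v) hν0.le hν1.le hy (by linarith)
    have hc : 0 ≤ ν * (x - v / 2) ^ (1 - ν) := by positivity
    have hinv : (x - v)⁻¹ + 3 / 2 * x⁻¹ + 1 / 2 * (x + v)⁻¹ - 3 * (x - v / 2)⁻¹ ≤ 0 := by
      have p1 : 0 < x - v := by linarith
      have p2 : 0 < x := by linarith
      have p3 : 0 < x + v := by linarith
      obtain ⟨z, hz⟩ : ∃ z, z = 2 * x - v := ⟨_, rfl⟩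
      have p4 : 0 < z := by linarith
      have e4 : x - v / 2 = z / 2 := by linarith
      rw [e4]
      have : (x - v)⁻¹ + 3 / 2 * x⁻¹ + 1 / 2 * (x + v)⁻¹ - 3 * (z / 2)⁻¹
          = -(v * (4 * x ^ 2 - 5 * x * v - 3 * v ^ 2))
            / (2 * z * (x - v) * x * (x + v)) := by
        field_simp
        rw [hz]
        ring
      rw [this]
      apply div_nonpos_of_nonpos_of_nonneg _ (by positivity)
      have : 0 ≤ 4 * x ^ 2 - 5 * x * v - 3 * v ^ 2 := by nlinarith
      nlinarith [mul_nonneg hv0 this]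
    have h3 : (x - v) ^ (-ν) + 3 / 2 * x ^ (-ν) + 1 / 2 * (x + v) ^ (-ν)
        ≤ 3 * (x - v / 2) ^ (-ν) := by
      nlinarith [mul_le_mul_of_nonneg_left hinv hc]
    have h4 := mul_le_mul_of_nonneg_left h3 (mul_nonneg hv0 (by linarith : 0 ≤ 1 - ν))
    have h5 : 3 / 4 * ((x - v) ^ (1 - ν) + (x + v) ^ (1 - ν)) - 3 / 2 * x ^ (1 - ν)
        + v / 4 * ((1 - ν) * (x - v) ^ (-ν) - (1 - ν) * (x + v) ^ (-ν)) ≤ 0 := by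
      linarith
    have := mul_le_mul_of_nonneg_left h5 (by linarith : 0 ≤ 2 - ν)
    linarith

lemma right_weighted_le {ν s : ℝ} (hν0 : 0 < ν) (hν1 : ν < 1) (hs : 2 ≤ s) :
    -((2 - ν) / 2) * (s ^ (1 - ν) + 3 * (s + 2) ^ (1 - ν)) - s ^ (2 - ν) + (s + 2) ^ (2 - ν)
      ≤ 0 := by
  obtain ⟨x, rfl⟩ : ∃ x, s = x - 2 := ⟨s + 2, by ring⟩
  have hx : 4 ≤ x := by linarith
  have key := nonpos_of_hasDerivAt_nonpos (b := 2)
    (φ := fun u => -((2 - ν) / 4) * (u * ((x + (-1) * u) ^ (1 - ν) + 3 * x ^ (1 - ν)))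
      - (x + (-1) * u) ^ (2 - ν) + x ^ (2 - ν))
    (φ' := fun u => -((2 - ν) / 4) * (1 * ((x + (-1) * u) ^ (1 - ν) + 3 * x ^ (1 - ν))
      + u * ((1 - ν) * (-1) * (x + (-1) * u) ^ (1 - ν - 1)))
      - (2 - ν) * (-1) * (x + (-1) * u) ^ (2 - ν - 1)) (by norm_num) (by simp) ?_ ?_
  · have e1 : x + -1 * 2 = x - 2 := by ring
    rw [e1] at key
    rw [sub_add_cancel]
    linarith
  · rintro v ⟨hv0, hv1⟩
    exact ((((hasDerivAt_id v).mul ((hasDerivAt_rpow_affine (by linarith)).add_const _)).const_mul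
      _).sub (hasDerivAt_rpow_affine (by linarith))).add_const _
  · rintro v ⟨hv0, hv1⟩
    have e : (2 - ν - 1 : ℝ) = 1 - ν := by ring
    have e' : (1 - ν - 1 : ℝ) = -ν := by ring
    have e1 : x + -1 * v = x - v := by ring
    simp only [e, e', e1, one_mul]
    have h1 := rpow_le_tangent (p := 1 - ν) (x := x) (t := x - v) (by linarith) (by linarith)
      (by linarith) (by linarith)
    rw [e'] at h1
    have h2 := rpow_neg_le_tangent_inv (y := x) (t := x - v) hν0.le hν1.le (by linarith)
      (by linarith)
    have hX : (0 : ℝ) < x := by linarith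
    have h3 : (x - v)⁻¹ ≤ 2 * x⁻¹ := by
      rw [← div_eq_mul_inv, inv_eq_one_div, div_le_div_iff₀ (by linarith) hX]
      linarith
    have h4 : x ^ (1 - ν) * x⁻¹ = x ^ (-ν) := by
      rw [← e', Real.rpow_sub_one hX.ne', div_eq_mul_inv]
    have hp : 0 < x ^ (-ν) := by positivity
    have h5 : (x - v) ^ (-ν) ≤ 3 * x ^ (-ν) := by
      have := mul_le_mul_of_nonneg_left h3 (by positivity : 0 ≤ ν * x ^ (1 - ν))
      nlinarith
    have h6 := mul_le_mul_of_nonneg_left h5 (mul_nonneg hv0 (by linarith : 0 ≤ 1 - ν))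
    have h7 : 3 / 4 * ((x - v) ^ (1 - ν) - x ^ (1 - ν)) + v / 4 * ((1 - ν) * (x - v) ^ (-ν)) ≤ 0 := by
      linarith
    have := mul_le_mul_of_nonneg_left h7 (by linarith : 0 ≤ 2 - ν)
    linarith

lemma rpow_sub_rpow_succ_le {ν s : ℝ} (hν0 : 0 < ν) (hν1 : ν < 1) (hs : 0 < s) :
    (2 - ν) / 2 * (s ^ (1 - ν) - 3 * (s + 1) ^ (1 - ν)) - s ^ (2 - ν) + (s + 1) ^ (2 - ν) ≤ 0 := by
  have key := nonpos_of_hasDerivAt_nonpos (b := 1)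
    (φ := fun u => (2 - ν) / 2 * (u * (s ^ (1 - ν) - 3 * (s + 1 * u) ^ (1 - ν))) - s ^ (2 - ν)
      + (s + 1 * u) ^ (2 - ν))
    (φ' := fun u => (2 - ν) / 2 * (1 * (s ^ (1 - ν) - 3 * (s + 1 * u) ^ (1 - ν))
      + u * (-(3 * ((1 - ν) * 1 * (s + 1 * u) ^ (1 - ν - 1)))))
      + (2 - ν) * 1 * (s + 1 * u) ^ (2 - ν - 1)) (by norm_num) (by simp) ?_ ?_
  · simp only [one_mul, mul_one] at key
    linarith
  · rintro v ⟨hv0, hv1⟩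
    exact ((((hasDerivAt_id v).mul (((hasDerivAt_rpow_affine (by linarith)).const_mul _).const_sub
      _)).const_mul _).sub_const _).add (hasDerivAt_rpow_affine (by linarith))
  · rintro v ⟨hv0, hv1⟩
    have h1 : s ^ (1 - ν) ≤ (s + 1 * v) ^ (1 - ν) :=
      Real.rpow_le_rpow hs.le (by linarith) (by linarith)
    have e : (2 - ν - 1 : ℝ) = 1 - ν := by ring
    simp only [e]
    have hp : 0 ≤ (2 - ν) * v * ((1 - ν) * (s + 1 * v) ^ (1 - ν - 1)) := by
      have : 0 < (s + 1 * v) ^ (1 - ν - 1) := Real.rpow_pos_of_pos (by linarith) _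
      have : 0 < 1 - ν := by linarith
      have : 0 < 2 - ν := by linarith
      positivity
    have := mul_le_mul_of_nonneg_left h1 (by linarith : 0 ≤ (2 - ν) / 2)
    linarith

lemma odd_coeff_one_le {ν s : ℝ} (hν0 : 0 < ν) (hν1 : ν < 1) (hs : 4 ≤ s) :
    -((2 - ν) / 2) * ((s - 2) ^ (1 - ν) + 3 * s ^ (1 - ν) - 4 * (s + 1) ^ (1 - ν))
      - (s - 2) ^ (2 - ν) + 3 * s ^ (2 - ν) - 2 * (s + 1) ^ (2 - ν) ≤ 0 := by
  have key := nonpos_of_hasDerivAt_nonpos (b := 1)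
    (φ := fun u => -((2 - ν) / 2) * (u * ((s + (-2) * u) ^ (1 - ν) + 3 * s ^ (1 - ν)
      - 4 * (s + 1 * u) ^ (1 - ν))) - (s + (-2) * u) ^ (2 - ν) + 3 * s ^ (2 - ν)
      - 2 * (s + 1 * u) ^ (2 - ν))
    (φ' := fun u => -((2 - ν) / 2) * (1 * ((s + (-2) * u) ^ (1 - ν) + 3 * s ^ (1 - ν)
      - 4 * (s + 1 * u) ^ (1 - ν)) + u * ((1 - ν) * (-2) * (s + (-2) * u) ^ (1 - ν - 1)
      - 4 * ((1 - ν) * 1 * (s + 1 * u) ^ (1 - ν - 1))))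
      - (2 - ν) * (-2) * (s + (-2) * u) ^ (2 - ν - 1)
      - 2 * ((2 - ν) * 1 * (s + 1 * u) ^ (2 - ν - 1)))
    (by norm_num) (by simp only [mul_zero, add_zero, zero_mul]; ring) ?_ ?_
  · have e1 : s + -2 * 1 = s - 2 := by ring
    rw [e1] at key
    simp only [one_mul] at key
    linarith
  · rintro v ⟨hv0, hv1⟩
    exact (((((hasDerivAt_id v).mul (((hasDerivAt_rpow_affine (by linarith)).add_const _).sub
      ((hasDerivAt_rpow_affine (by linarith)).const_mul _))).const_mul _).sub
      (hasDerivAt_rpow_affine (by linarith))).add_const _).sub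
      ((hasDerivAt_rpow_affine (by linarith)).const_mul _)
  · rintro v ⟨hv0, hv1⟩
    have e : (2 - ν - 1 : ℝ) = 1 - ν := by ring
    have e' : (1 - ν - 1 : ℝ) = -ν := by ring
    have e1 : s + -2 * v = s - 2 * v := by ring
    simp only [e, e', e1, one_mul]
    have hm := midpoint_le_rpow_sub (x := s - v) (u := v) hν0 hν1 hv0 (by linarith)
    rw [sub_add_cancel, sub_sub, ← two_mul] at hm
    have hy : 0 < s - v := by linarith
    have i1 := rpow_neg_le_tangent_inv (t := s - 2 * v) hν0.le hν1.le hy (by linarith)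
    have i2 := rpow_neg_le_tangent_inv (t := s + v) hν0.le hν1.le hy (by linarith)
    have hc : 0 ≤ ν * (s - v) ^ (1 - ν) := by positivity
    have hinv : (s - 2 * v)⁻¹ + 2 * (s + v)⁻¹ - 3 * (s - v)⁻¹ ≤ 0 := by
      have p1 : 0 < s - 2 * v := by linarith
      have p3 : 0 < s + v := by linarith
      have : (s - 2 * v)⁻¹ + 2 * (s + v)⁻¹ - 3 * (s - v)⁻¹
          = -(3 * (v * (s - 3 * v))) / ((s - 2 * v) * (s + v) * (s - v)) := by
        field_simp
        ring
      rw [this]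
      apply div_nonpos_of_nonpos_of_nonneg _ (by positivity)
      nlinarith [mul_nonneg hv0 (by linarith : 0 ≤ s - 3 * v)]
    have h3 : (s - 2 * v) ^ (-ν) + 2 * (s + v) ^ (-ν) ≤ 3 * (s - v) ^ (-ν) := by
      nlinarith [mul_le_mul_of_nonneg_left hinv hc]
    have h4 := mul_le_mul_of_nonneg_left h3 (mul_nonneg hv0 (by linarith : 0 ≤ 1 - ν))
    have h5 : 3 / 2 * ((s - 2 * v) ^ (1 - ν) - s ^ (1 - ν))
        + v * ((1 - ν) * (s - 2 * v) ^ (-ν)) + 2 * v * ((1 - ν) * (s + v) ^ (-ν)) ≤ 0 := by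
      linarith
    have := mul_le_mul_of_nonneg_left h5 (by linarith : 0 ≤ 2 - ν)
    linarith

lemma odd_coeff_two_le {ν s : ℝ} (hν0 : 0 < ν) (hν1 : ν < 1) (hs : 4 ≤ s) :
    (2 - ν) / 2 * (4 * (s - 2) ^ (1 - ν) + 3 * s ^ (1 - ν) - (s + 1) ^ (1 - ν))
      + 2 * (s - 2) ^ (2 - ν) - 3 * s ^ (2 - ν) + (s + 1) ^ (2 - ν) ≤ 0 := by
  have key := nonpos_of_hasDerivAt_nonpos (b := 1)
    (φ := fun u => (2 - ν) / 2 * (u * (4 * (s + (-2) * u) ^ (1 - ν) + 3 * s ^ (1 - ν)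
      - (s + 1 * u) ^ (1 - ν))) + 2 * (s + (-2) * u) ^ (2 - ν) - 3 * s ^ (2 - ν)
      + (s + 1 * u) ^ (2 - ν))
    (φ' := fun u => (2 - ν) / 2 * (1 * (4 * (s + (-2) * u) ^ (1 - ν) + 3 * s ^ (1 - ν)
      - (s + 1 * u) ^ (1 - ν)) + u * (4 * ((1 - ν) * (-2) * (s + (-2) * u) ^ (1 - ν - 1))
      - (1 - ν) * 1 * (s + 1 * u) ^ (1 - ν - 1)))
      + 2 * ((2 - ν) * (-2) * (s + (-2) * u) ^ (2 - ν - 1))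
      + (2 - ν) * 1 * (s + 1 * u) ^ (2 - ν - 1))
    (by norm_num) (by simp only [mul_zero, add_zero, zero_mul]; ring) ?_ ?_
  · have e1 : s + -2 * 1 = s - 2 := by ring
    rw [e1] at key
    simp only [one_mul] at key
    linarith
  · rintro v ⟨hv0, hv1⟩
    exact (((((hasDerivAt_id v).mul ((((hasDerivAt_rpow_affine (by linarith)).const_mul
      _).add_const _).sub (hasDerivAt_rpow_affine (by linarith)))).const_mul _).add
      ((hasDerivAt_rpow_affine (by linarith)).const_mul _)).sub_const _).add
      (hasDerivAt_rpow_affine (by linarith))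
  · rintro v ⟨hv0, hv1⟩
    have e : (2 - ν - 1 : ℝ) = 1 - ν := by ring
    have e' : (1 - ν - 1 : ℝ) = -ν := by ring
    have e1 : s + -2 * v = s - 2 * v := by ring
    simp only [e, e', e1, one_mul]
    have concave (x t : ℝ) (hx : 0 < x) (ht : 0 < t) :=
      rpow_le_tangent (p := 1 - ν) (x := x) (t := t) (by linarith) (by linarith) hx ht.le
    have t1 := concave (s - 2 * v) (s - v) (by linarith) (by linarith)
    have t2 := concave (s - v) s (by linarith) (by linarith)
    have t3 := concave s (s + v) (by linarith) (by linarith)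
    rw [e'] at t1 t2 t3
    have convex (x t : ℝ) := tangent_le_rpow_neg (ν := ν) (x := x) (t := t) hν0
    have c1 := convex (s - v) (s - 2 * v) (by linarith) (by linarith)
    have c2 := convex (s - v) s (by linarith) (by linarith)
    have c3 := convex s (s - v) (by linarith) (by linarith)
    have c4 := convex s (s + v) (by linarith) (by linarith)
    have hanti : (s + v) ^ (-ν) ≤ s ^ (-ν) :=
      Real.rpow_le_rpow_of_nonpos (by linarith) (by linarith) (by linarith)
    have h3 : 2 * (s - v) ^ (-ν) + 1 / 2 * s ^ (-ν) ≤ 2 * (s - 2 * v) ^ (-ν)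
        + 1 / 2 * (s + v) ^ (-ν) := by linarith
    have h4 := mul_le_mul_of_nonneg_left h3 (mul_nonneg hv0 (by linarith : 0 ≤ 1 - ν))
    have h5 : -2 * (s - 2 * v) ^ (1 - ν) + 3 / 2 * s ^ (1 - ν) + 1 / 2 * (s + v) ^ (1 - ν)
        - 4 * v * ((1 - ν) * (s - 2 * v) ^ (-ν)) - 1 / 2 * v * ((1 - ν) * (s + v) ^ (-ν)) ≤ 0 := by
      linarith
    have := mul_le_mul_of_nonneg_left h5 (by linarith : 0 ≤ 2 - ν)
    linarith

lemma Gamma_three_sub_pos {ν : ℝ} (hν1 : ν < 1) : 0 < Real.Gamma (3 - ν) :=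
  Real.Gamma_pos_of_pos (by linarith)

lemma alpha0_pos {ν : ℝ} (hν0 : 0 < ν) (hν1 : ν < 1) : 0 < alpha0 ν := by
  have := Gamma_three_sub_pos hν1
  unfold alpha0
  positivity

lemma two_rpow_one_sub (ν : ℝ) : (2 : ℝ) ^ (1 - ν) = 2 / 2 ^ ν := by
  rw [Real.rpow_sub (by norm_num), Real.rpow_one]

lemma two_rpow_two_sub (ν : ℝ) : (2 : ℝ) ^ (2 - ν) = 4 / 2 ^ ν := by
  rw [Real.rpow_sub (by norm_num)]
  norm_num

lemma four_rpow (ν : ℝ) : (4 : ℝ) ^ ν = (2 ^ ν) ^ 2 := by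
  rw [sq, ← Real.mul_rpow (by norm_num) (by norm_num)]
  norm_num

lemma four_rpow_one_sub (ν : ℝ) : (4 : ℝ) ^ (1 - ν) = 4 / (2 ^ ν) ^ 2 := by
  rw [Real.rpow_sub (by norm_num), Real.rpow_one, four_rpow]

lemma four_rpow_two_sub (ν : ℝ) : (4 : ℝ) ^ (2 - ν) = 16 / (2 ^ ν) ^ 2 := by
  rw [Real.rpow_sub (by norm_num), ← four_rpow]
  norm_num

lemma quadratic_le_two_rpow {ν : ℝ} (hν0 : 0 < ν) :
    1 + 0.693 * ν + 0.24 * ν ^ 2 ≤ (2 : ℝ) ^ ν := by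
  have hl : (0.693 : ℝ) ≤ Real.log 2 := by linarith [Real.log_two_gt_d9]
  rw [Real.rpow_def_of_pos (by norm_num)]
  have h := Real.quadratic_le_exp_of_nonneg (mul_nonneg (by linarith : 0 ≤ Real.log 2) hν0.le)
  have h1 := mul_le_mul_of_nonneg_right hl hν0.le
  have h2 : (0.693 * ν) ^ 2 ≤ (Real.log 2 * ν) ^ 2 := by gcongr
  nlinarith [sq_nonneg ν]

lemma Dbar_even {ν : ℝ} {m k : ℕ} (hk : k ≠ 0) :
    Dbar ν m (2 * k) = (1 / Real.Gamma (3 - ν)) *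
      (-((2 - ν) / 2) * (((2 * m : ℝ) - 2 * k) ^ (1 - ν)
          + 6 * ((2 * m : ℝ) - 2 * k + 2) ^ (1 - ν) + ((2 * m : ℝ) - 2 * k + 4) ^ (1 - ν))
        - ((2 * m : ℝ) - 2 * k) ^ (2 - ν) + ((2 * m : ℝ) - 2 * k + 4) ^ (2 - ν)) := by
  have h1 : 2 * k ≠ 0 := by omega
  have h2 : 2 * k % 2 = 0 := by omega
  have h3 : 2 * k / 2 = k := by omega
  rw [Dbar, if_neg h1, if_pos h2, h3]

lemma Dbar_odd {ν : ℝ} {m k : ℕ} :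
    Dbar ν m (2 * k + 1) = (2 / Real.Gamma (3 - ν)) *
      ((2 - ν) * (((2 * m : ℝ) - 2 * k) ^ (1 - ν) + ((2 * m : ℝ) - 2 * k + 2) ^ (1 - ν))
        + ((2 * m : ℝ) - 2 * k) ^ (2 - ν) - ((2 * m : ℝ) - 2 * k + 2) ^ (2 - ν)) := by
  have h1 : 2 * k + 1 ≠ 0 := by omega
  have h2 : ¬ (2 * k + 1) % 2 = 0 := by omega
  have h3 : (2 * k + 1) / 2 = k := by omega
  rw [Dbar, if_neg h1, if_neg h2, h3]

lemma Dbar_nonpos {ν : ℝ} (hν0 : 0 < ν) (hν1 : ν < 1) {m k : ℕ} (hk : k < 2 * m) :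
    Dbar ν m k ≤ 0 := by
  have hΓ := Gamma_three_sub_pos hν1
  obtain ⟨i, rfl | rfl⟩ := Nat.even_or_odd' k
  · have him : (i : ℝ) + 1 ≤ m := by exact_mod_cast (by omega : i + 1 ≤ m)
    rcases eq_or_ne i 0 with rfl | hi
    · rw [Dbar, if_pos (by rfl)]
      have : (1 : ℝ) ≤ m := by simpa using him
      exact mul_nonpos_of_nonneg_of_nonpos (by positivity)
        (right_weighted_le hν0 hν1 (by linarith))
    · rw [Dbar_even hi]
      exact mul_nonpos_of_nonneg_of_nonpos (by positivity)
        (three_panel_le hν0 hν1 (by linarith))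
  · have him : (i : ℝ) + 1 ≤ m := by exact_mod_cast (by omega : i + 1 ≤ m)
    rw [Dbar_odd]
    exact mul_nonpos_of_nonneg_of_nonpos (by positivity) (trapezoid_le hν0 hν1 (by linarith))

lemma Dbar_last {ν : ℝ} (hν0 : 0 < ν) (hν1 : ν < 1) (m : ℕ) :
    Dbar ν m (2 * m + 1) = -(2 * theta ν * alpha0 ν) := by
  have hΓ := Gamma_three_sub_pos hν1
  have h2 : (0 : ℝ) < 2 ^ ν := by positivity
  rw [Dbar_odd, sub_self, zero_add, Real.zero_rpow (by linarith), Real.zero_rpow (by linarith),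
    two_rpow_one_sub, two_rpow_two_sub, theta, alpha0]
  field_simp
  ring

lemma Dbar_penultimate_le {ν : ℝ} (hν0 : 0 < ν) (hν1 : ν < 1) {m : ℕ} (hm : m ≠ 0) :
    Dbar ν m (2 * m) ≤ theta ν ^ 2 * alpha0 ν := by
  have hΓ := Gamma_three_sub_pos hν1
  have hp := quadratic_le_two_rpow hν0
  have h2 : (0 : ℝ) < 2 ^ ν := by positivity
  rw [Dbar_even hm, sub_self, zero_add, zero_add, Real.zero_rpow (by linarith),
    Real.zero_rpow (by linarith), two_rpow_one_sub, four_rpow_one_sub, four_rpow_two_sub, theta,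
    alpha0]
  set p := (2 : ℝ) ^ ν
  have key : 0 ≤ (24 - 2 * ν ^ 2) * p - (24 + 16 * ν + 2 * ν ^ 2) := by
    have h3 : 0 ≤ 24 - 2 * ν ^ 2 := by nlinarith
    have h4 : ν ^ 2 ≤ ν := by nlinarith
    have h5 : ν ^ 3 ≤ ν := by nlinarith [mul_nonneg hν0.le (sub_nonneg.2 h4)]
    have h6 : ν ^ 4 ≤ ν ^ 2 := by nlinarith [sq_nonneg ν]
    have h7 : ν ^ 3 ≤ ν ^ 2 := by nlinarith [sq_nonneg ν]
    nlinarith [mul_le_mul_of_nonneg_left hp h3]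
  rw [← sub_nonneg]
  have : (2 * ν / (2 + ν)) ^ 2 * ((ν + 2) / (p * Real.Gamma (3 - ν))) -
      1 / Real.Gamma (3 - ν) * (-((2 - ν) / 2) * (0 + 6 * (2 / p) + 4 / p ^ 2) - 0 + 16 / p ^ 2)
      = ((24 - 2 * ν ^ 2) * p - (24 + 16 * ν + 2 * ν ^ 2))
        / ((2 + ν) * p ^ 2 * Real.Gamma (3 - ν)) := by
    field_simp
    ring
  rw [this]
  positivity

/-- Closed form of the partial sums of the coefficients, as a function of `r = 2m - 2k`. -/
noncomputable def partialSum (ν r : ℝ) : ℝ :=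
  (1 / Real.Gamma (3 - ν)) * ((2 - ν) / 2 * (3 * r ^ (1 - ν) + (r + 2) ^ (1 - ν))
    + r ^ (2 - ν) - (r + 2) ^ (2 - ν))

lemma partialSum_zero {ν : ℝ} (hν1 : ν < 1) : partialSum ν 0 = -alpha0 ν := by
  have hΓ := Gamma_three_sub_pos hν1
  have h2 : (0 : ℝ) < 2 ^ ν := by positivity
  rw [partialSum, alpha0, zero_add, Real.zero_rpow (by linarith), Real.zero_rpow (by linarith),
    two_rpow_one_sub, two_rpow_two_sub]
  field_simp
  ring

lemma partialSum_succ (ν : ℝ) (m k : ℕ) :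
    partialSum ν (2 * m - 2 * k) + (Dbar ν m (2 * (k + 1)) + Dbar ν m (2 * (k + 1) + 1))
      = partialSum ν (2 * m - 2 * (k + 1 : ℕ)) := by
  rw [Dbar_even k.succ_ne_zero, Dbar_odd, partialSum, partialSum]
  have e1 : (2 * m - 2 * (k + 1 : ℕ) + 2 : ℝ) = 2 * m - 2 * k := by push_cast; ring
  have e2 : (2 * m - 2 * (k + 1 : ℕ) + 4 : ℝ) = 2 * m - 2 * k + 2 := by push_cast; ring
  rw [e1, e2]
  ring

lemma sum_range_Dbar (ν : ℝ) (m k : ℕ) :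
    ∑ i ∈ Finset.range (2 * k + 2), Dbar ν m i = partialSum ν (2 * m - 2 * k) := by
  induction k with
  | zero =>
    have h1 := Dbar_odd (ν := ν) (m := m) (k := 0)
    rw [mul_zero, zero_add] at h1
    rw [mul_zero, zero_add, Finset.sum_range_succ, Finset.sum_range_one, h1, Dbar, if_pos rfl,
      partialSum]
    simp only [Nat.cast_zero, mul_zero, sub_zero]
    ring
  | succ k ih =>
    rw [← partialSum_succ, ← ih, show 2 * (k + 1) + 2 = 2 * k + 2 + 1 + 1 from rfl,
      Finset.sum_range_succ, Finset.sum_range_succ, add_assoc]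
    rfl

lemma sum_range_Dco (ν : ℝ) (m k : ℕ) :
    ∑ i ∈ Finset.range (2 * k + 3), Dco ν m i = partialSum ν (2 * m - 2 * (k + 1 : ℕ)) := by
  induction k with
  | zero =>
    simp only [mul_zero, zero_add, Finset.sum_range_succ, Finset.sum_range_zero, Dco, partialSum,
      if_true, one_ne_zero, OfNat.ofNat_ne_zero, OfNat.ofNat_ne_one, if_false, Nat.cast_one,
      mul_one, sub_add_cancel]
    ring
  | succ k ih =>
    have d (i : ℕ) : Dco ν m (i + 3) = Dbar ν m (i + 4) := by simp [Dco]
    rw [← partialSum_succ, ← ih, show 2 * (k + 1) + 3 = 2 * k + 3 + 1 + 1 from rfl,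
      Finset.sum_range_succ, Finset.sum_range_succ, add_assoc, d,
      show 2 * k + 3 + 1 = 2 * k + 1 + 3 from rfl, d]
    rfl

lemma Dco_zero_nonpos {ν : ℝ} (hν0 : 0 < ν) (hν1 : ν < 1) {m : ℕ} (hm : m ≠ 0) :
    Dco ν m 0 ≤ 0 := by
  have hΓ := Gamma_three_sub_pos hν1
  have hm' : (0 : ℝ) < m := by exact_mod_cast Nat.pos_of_ne_zero hm
  rw [Dco, if_pos rfl]
  exact mul_nonpos_of_nonneg_of_nonpos (by positivity)
    (rpow_sub_rpow_succ_le hν0 hν1 (by positivity))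

lemma Dco_nonpos {ν : ℝ} (hν0 : 0 < ν) (hν1 : ν < 1) {m k : ℕ} (hm : 2 ≤ m)
    (hk : k + 2 ≤ 2 * m) : Dco ν m k ≤ 0 := by
  have hΓ := Gamma_three_sub_pos hν1
  have hm' : (2 : ℝ) ≤ m := by exact_mod_cast hm
  match k with
  | 0 => exact Dco_zero_nonpos hν0 hν1 (by omega)
  | 1 =>
    rw [Dco, if_neg (by norm_num), if_pos rfl]
    exact mul_nonpos_of_nonneg_of_nonpos (by positivity)
      (odd_coeff_one_le hν0 hν1 (by linarith))
  | 2 =>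
    rw [Dco, if_neg (by norm_num), if_neg (by norm_num), if_pos rfl]
    exact mul_nonpos_of_nonneg_of_nonpos (by positivity)
      (odd_coeff_two_le hν0 hν1 (by linarith))
  | k + 3 =>
    have : Dco ν m (k + 3) = Dbar ν m (k + 4) := by simp [Dco]
    rw [this]
    exact Dbar_nonpos hν0 hν1 (by omega)

lemma theta_nonneg {ν : ℝ} (hν0 : 0 < ν) : 0 ≤ theta ν := by
  unfold theta; positivity

lemma theta_le {ν : ℝ} (hν0 : 0 < ν) (hν1 : ν < 1) : theta ν ≤ 2 / 3 := by
  rw [theta, div_le_div_iff₀ (by linarith) (by norm_num)]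
  linarith

/-- The properties of the coefficients of one step, `d n` and `d (n + 1)`, `d (n + 2)` being the
last ones, that make the step stable. -/
structure StableCoeffs (θ : ℝ) (d : ℕ → ℝ) (n : ℕ) : Prop where
  sum_eq : ∑ k ∈ Finset.range (n + 3), d k = 1
  nonneg : ∀ k ≤ n, 0 ≤ d k
  le_last : θ ≤ d (n + 2)
  le_penultimate : -(θ * (d (n + 2) - θ)) ≤ d (n + 1)
  neg_half_le : -(1 / 2) ≤ d (n + 1)

lemma StableCoeffs.of_last_eq {θ : ℝ} {d : ℕ → ℝ} {n : ℕ} (hθ0 : 0 ≤ θ) (hθ1 : θ ≤ 2 / 3)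
    (hsum : ∑ k ∈ Finset.range (n + 3), d k = 1) (hnn : ∀ k ≤ n, 0 ≤ d k)
    (hlast : d (n + 2) = 2 * θ) (hpen : -θ ^ 2 ≤ d (n + 1)) : StableCoeffs θ d n where
  sum_eq := hsum
  nonneg := hnn
  le_last := by linarith
  le_penultimate := by rw [hlast]; linarith
  neg_half_le := by nlinarith

lemma stableCoeffs_even {ν : ℝ} (hν0 : 0 < ν) (hν1 : ν < 1) (i : ℕ) :
    StableCoeffs (theta ν) (dco ν (2 * i + 1 + 3)) (2 * i + 1) := by
  have hα := alpha0_pos hν0 hν1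
  have hd (k : ℕ) : dco ν (2 * i + 1 + 3) k = -Dbar ν (i + 1) k / alpha0 ν := by
    rw [dco, if_neg (by omega), show (2 * i + 1 + 3) / 2 - 1 = i + 1 by omega]
  apply StableCoeffs.of_last_eq (theta_nonneg hν0) (theta_le hν0 hν1)
  · simp only [hd]
    rw [← Finset.sum_div, Finset.sum_neg_distrib,
      show 2 * i + 1 + 3 = 2 * (i + 1) + 2 from rfl, sum_range_Dbar, sub_self,
      partialSum_zero hν1, neg_neg, div_self hα.ne']
  · intro k hk
    rw [hd]
    exact div_nonneg (neg_nonneg.2 (Dbar_nonpos hν0 hν1 (by omega))) hα.le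
  · rw [hd, show 2 * i + 1 + 2 = 2 * (i + 1) + 1 from rfl, Dbar_last hν0 hν1]
    field_simp
  · rw [hd, show 2 * i + 1 + 1 = 2 * (i + 1) from rfl, le_div_iff₀ hα]
    linarith [Dbar_penultimate_le hν0 hν1 i.succ_ne_zero]

lemma stableCoeffs_odd {ν : ℝ} (hν0 : 0 < ν) (hν1 : ν < 1) (i : ℕ) :
    StableCoeffs (theta ν) (dco ν (2 * (i + 1) + 3)) (2 * (i + 1)) := by
  have hα := alpha0_pos hν0 hν1
  have hd (k : ℕ) : dco ν (2 * (i + 1) + 3) k = -Dco ν (i + 2) k / alpha0 ν := by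
    rw [dco, if_pos (by omega), show (2 * (i + 1) + 3) / 2 = i + 2 by omega]
  have hD (k : ℕ) : Dco ν (i + 2) (k + 3) = Dbar ν (i + 2) (k + 4) := by simp [Dco]
  apply StableCoeffs.of_last_eq (theta_nonneg hν0) (theta_le hν0 hν1)
  · simp only [hd]
    rw [← Finset.sum_div, Finset.sum_neg_distrib, sum_range_Dco, sub_self,
      partialSum_zero hν1, neg_neg, div_self hα.ne']
  · intro k hk
    rw [hd]
    exact div_nonneg (neg_nonneg.2 (Dco_nonpos hν0 hν1 (by omega) (by omega))) hα.le
  · rw [hd, show 2 * (i + 1) + 2 = 2 * i + 1 + 3 from rfl, hD,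
      show 2 * i + 1 + 4 = 2 * (i + 2) + 1 from rfl, Dbar_last hν0 hν1]
    field_simp
  · rw [hd, show 2 * (i + 1) + 1 = 2 * i + 3 from rfl, hD,
      show 2 * i + 4 = 2 * (i + 2) from rfl, le_div_iff₀ hα]
    linarith [Dbar_penultimate_le hν0 hν1 (i + 1).succ_ne_zero]

lemma dco_three_one {ν : ℝ} (hν0 : 0 < ν) (hν1 : ν < 1) :
    dco ν 3 1 = (3 / 2 : ℝ) ^ (1 - ν) * (4 + 4 * ν) / (2 + ν) - 3 := by
  have hΓ := Gamma_three_sub_pos hν1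
  have h2 : (0 : ℝ) < 2 ^ ν := by positivity
  have e1 : (2 * (1 : ℕ) : ℝ) = 2 := by norm_num
  have e2 : (2 + 1 : ℝ) = 3 := by norm_num
  have e3 : (2 - ν : ℝ) = 1 - ν + 1 := by ring
  have e4 : (3 : ℝ) ^ (2 - ν) = 3 * 3 ^ (1 - ν) := by
    rw [e3, Real.rpow_add_one (by norm_num), mul_comm]
  rw [dco, if_pos rfl, show 3 / 2 = 1 from rfl, Dco, if_neg one_ne_zero, if_pos rfl, e1, sub_self,
    e2, e4, Real.zero_rpow (by linarith), Real.zero_rpow (by linarith), alpha0,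
    Real.div_rpow (by norm_num) (by norm_num), two_rpow_one_sub, two_rpow_two_sub]
  field_simp
  ring

lemma dco_three_two {ν : ℝ} (hν0 : 0 < ν) (hν1 : ν < 1) :
    dco ν 3 2 = 3 - (3 / 2 : ℝ) ^ (1 - ν) * (4 + ν) / (2 + ν) := by
  have hΓ := Gamma_three_sub_pos hν1
  have h2 : (0 : ℝ) < 2 ^ ν := by positivity
  have e1 : (2 * (1 : ℕ) : ℝ) = 2 := by norm_num
  have e2 : (2 + 1 : ℝ) = 3 := by norm_num
  have e3 : (2 - ν : ℝ) = 1 - ν + 1 := by ring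
  have e4 : (3 : ℝ) ^ (2 - ν) = 3 * 3 ^ (1 - ν) := by
    rw [e3, Real.rpow_add_one (by norm_num), mul_comm]
  rw [dco, if_pos rfl, show 3 / 2 = 1 from rfl, Dco, if_neg two_ne_zero, if_neg (by norm_num),
    if_pos rfl, e1, sub_self,
    e2, e4, Real.zero_rpow (by linarith), Real.zero_rpow (by linarith), alpha0,
    Real.div_rpow (by norm_num) (by norm_num), two_rpow_one_sub, two_rpow_two_sub]
  field_simp
  ring

lemma stableCoeffs_three {ν : ℝ} (hν0 : 0 < ν) (hν1 : ν < 1) :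
    StableCoeffs (theta ν) (dco ν 3) 0 := by
  have hα := alpha0_pos hν0 hν1
  have hd (k : ℕ) : dco ν 3 k = -Dco ν 1 k / alpha0 ν := by
    rw [dco, if_pos rfl]
  set ρ := (3 / 2 : ℝ) ^ (1 - ν) with hρ
  have hρ1 : ρ ≤ (3 - ν) / 2 := by
    have := rpow_le_tangent (p := 1 - ν) (x := 1) (t := 3 / 2) (by linarith) (by linarith)
      (by norm_num) (by norm_num)
    rw [Real.one_rpow, Real.one_rpow] at this
    linarith
  have hρ0 : 3 ≤ ρ * (2 + ν) := by
    have := rpow_le_tangent (p := ν) (x := 1) (t := 3 / 2) (by linarith) (by linarith)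
      (by norm_num) (by norm_num)
    rw [Real.one_rpow, Real.one_rpow] at this
    have h3 : ρ * (3 / 2 : ℝ) ^ ν = 3 / 2 := by
      rw [hρ, ← Real.rpow_add (by norm_num), sub_add_cancel, Real.rpow_one]
    have : 0 < ρ := by positivity
    nlinarith
  have h1 := dco_three_one hν0 hν1
  have h2 := dco_three_two hν0 hν1
  rw [← hρ] at h1 h2
  have h2ν : 0 < 2 + ν := by linarith
  refine ⟨?_, ?_, ?_, ?_, ?_⟩
  · simp only [hd]
    rw [← Finset.sum_div, Finset.sum_neg_distrib]
    have := sum_range_Dco ν 1 0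
    rw [zero_add, sub_self, partialSum_zero hν1] at this
    rw [show 0 + 3 = 2 * 0 + 3 from rfl, this, neg_neg, div_self hα.ne']
  · intro k hk
    obtain rfl : k = 0 := by omega
    rw [hd]
    exact div_nonneg (neg_nonneg.2 (Dco_zero_nonpos hν0 hν1 one_ne_zero)) hα.le
  · rw [zero_add, h2, theta, ← sub_nonneg]
    have : 3 - ρ * (4 + ν) / (2 + ν) - 2 * ν / (2 + ν) = (6 + ν - ρ * (4 + ν)) / (2 + ν) := by
      field_simp
      ring
    rw [this]
    apply div_nonneg _ h2ν.le
    nlinarith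
  · rw [zero_add, zero_add, h1, h2, theta, ← sub_nonneg]
    have : ρ * (4 + 4 * ν) / (2 + ν) - 3
        - -(2 * ν / (2 + ν) * (3 - ρ * (4 + ν) / (2 + ν) - 2 * ν / (2 + ν)))
        = (ρ * (8 + 4 * ν + 2 * ν ^ 2) - (12 + ν ^ 2)) / (2 + ν) ^ 2 := by
      field_simp
      ring
    rw [this]
    apply div_nonneg _ (by positivity)
    have h3 : (12 + ν ^ 2) * (2 + ν) ≤ 3 * (8 + 4 * ν + 2 * ν ^ 2) := by
      nlinarith [mul_nonneg hν0.le hν0.le]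
    nlinarith [mul_le_mul_of_nonneg_right hρ0 (by positivity : 0 ≤ 8 + 4 * ν + 2 * ν ^ 2)]
  · rw [zero_add, h1, neg_le_sub_iff_le_add, ← sub_le_iff_le_add, le_div_iff₀ h2ν]
    nlinarith

lemma StableCoeffs.abs_sub_le {θ α K : ℝ} {d y : ℕ → ℝ} {n : ℕ} (hd : StableCoeffs θ d n)
    (hα : 0 < α) (hy : ∀ k < n + 3, |y k| ≤ K)
    (hz : |y (n + 2) - θ / (1 + α) * y (n + 1)| ≤ (1 - θ / (1 + α)) * K)
    (heq : (1 + α) * y (n + 3) = ∑ k ∈ Finset.range (n + 3), d k * y k) :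
    |y (n + 3) - θ / (1 + α) * y (n + 2)| ≤ (1 - θ / (1 + α)) * K := by
  have hK : 0 ≤ K := (abs_nonneg _).trans (hy 0 (by omega))
  obtain ⟨q, hq⟩ : ∃ q, q = 1 / (1 + α) := ⟨_, rfl⟩
  have hq0 : 0 < q := by rw [hq]; positivity
  have hq1 : q ≤ 1 := by rw [hq, div_le_one (by linarith)]; linarith
  have hqα : q * (1 + α) = 1 := by rw [hq]; field_simp
  have hθq : θ / (1 + α) = θ * q := by rw [hq]; ring
  rw [hθq] at hz ⊢
  have hsum := hd.sum_eq
  rw [Finset.sum_range_succ, Finset.sum_range_succ] at hsum heq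
  set S := ∑ k ∈ Finset.range (n + 1), d k * y k with hS
  have hSK : |S| ≤ (1 - d (n + 1) - d (n + 2)) * K := by
    calc |S| ≤ ∑ k ∈ Finset.range (n + 1), |d k * y k| := Finset.abs_sum_le_sum_abs _ _
      _ ≤ ∑ k ∈ Finset.range (n + 1), d k * K := by
          refine Finset.sum_le_sum fun k hk => ?_
          have hk := Finset.mem_range.1 hk
          have := hd.nonneg k (by omega)
          rw [abs_mul, abs_of_nonneg this]
          exact mul_le_mul_of_nonneg_left (hy k (by omega)) this
      _ = (1 - d (n + 1) - d (n + 2)) * K := by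
          rw [← Finset.sum_mul]
          congr 1
          linarith
  have h1 := hd.le_last
  have h2 := hd.le_penultimate
  have h3 := hd.neg_half_le
  obtain ⟨w, hw⟩ : ∃ w, w = d (n + 1) + θ * q * (d (n + 2) - θ) := ⟨_, rfl⟩
  have hdecomp : y (n + 3) - θ * q * y (n + 2) = q * ((d (n + 2) - θ)
      * (y (n + 2) - θ * q * y (n + 1)) + w * y (n + 1) + S) := by
    have : y (n + 3) = q * ((1 + α) * y (n + 3)) := by
      rw [← mul_assoc, hqα, one_mul]
    rw [this, heq, hw]
    ring
  have hA : |(d (n + 2) - θ) * (y (n + 2) - θ * q * y (n + 1))|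
      ≤ (d (n + 2) - θ) * ((1 - θ * q) * K) := by
    rw [abs_mul, abs_of_nonneg (by linarith)]
    exact mul_le_mul_of_nonneg_left hz (by linarith)
  have hB : |w * y (n + 1)| ≤ |w| * K := by
    rw [abs_mul]
    exact mul_le_mul_of_nonneg_left (hy _ (by omega)) (abs_nonneg _)
  have hcoef : q * ((d (n + 2) - θ) * (1 - θ * q) + |w| + (1 - d (n + 1) - d (n + 2)))
      ≤ 1 - θ * q := by
    rcases le_total 0 w with hw0 | hw0
    · rw [abs_of_nonneg hw0, hw]
      linarith
    · rw [abs_of_nonpos hw0]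
      have h4 : -w ≤ -d (n + 1) * (1 - q) := by
        rw [hw]
        nlinarith [mul_le_mul_of_nonneg_left h2 hq0.le]
      have h5 : -w ≤ 1 / 2 * (1 - q) := by nlinarith
      have h6 : q * (-2 * w) ≤ 1 - q := by nlinarith
      have : q * ((d (n + 2) - θ) * (1 - θ * q) + -w + (1 - d (n + 1) - d (n + 2)))
          = q * (-2 * w) + q - θ * q := by
        rw [hw]
        ring
      linarith
  calc |y (n + 3) - θ * q * y (n + 2)|
      = q * |(d (n + 2) - θ) * (y (n + 2) - θ * q * y (n + 1)) + w * y (n + 1) + S| := by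
        rw [hdecomp, abs_mul, abs_of_pos hq0]
    _ ≤ q * ((d (n + 2) - θ) * ((1 - θ * q) * K) + |w| * K
          + (1 - d (n + 1) - d (n + 2)) * K) := by
        gcongr
        exact (abs_add_three _ _ _).trans (by linarith)
    _ = q * ((d (n + 2) - θ) * (1 - θ * q) + |w| + (1 - d (n + 1) - d (n + 2))) * K := by ring
    _ ≤ (1 - θ * q) * K := mul_le_mul_of_nonneg_right hcoef hK

lemma abs_le_of_stableCoeffs {θ α K : ℝ} {d : ℕ → ℕ → ℝ} {y : ℕ → ℝ} (hθ0 : 0 ≤ θ)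
    (hα : 0 < α) (hd : ∀ n, StableCoeffs θ (d (n + 3)) n)
    (hy : ∀ k < 3, |y k| ≤ K) (hz : |y 2 - θ / (1 + α) * y 1| ≤ (1 - θ / (1 + α)) * K)
    (heq : ∀ n, (1 + α) * y (n + 3) = ∑ k ∈ Finset.range (n + 3), d (n + 3) k * y k) (k : ℕ) :
    |y k| ≤ K := by
  suffices h : ∀ n, (∀ k < n + 3, |y k| ≤ K) ∧
      |y (n + 2) - θ / (1 + α) * y (n + 1)| ≤ (1 - θ / (1 + α)) * K from
    (h k).1 k (by omega)
  intro n
  induction n with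
  | zero => exact ⟨hy, hz⟩
  | succ n ih =>
    have hstep := (hd n).abs_sub_le hα ih.1 ih.2 (heq n)
    refine ⟨fun k hk => ?_, hstep⟩
    rcases Nat.lt_succ_iff_lt_or_eq.1 hk with hk | rfl
    · exact ih.1 k hk
    · have hc : 0 ≤ θ / (1 + α) := by positivity
      have h2 := mul_le_mul_of_nonneg_left (ih.1 (n + 2) (by omega)) hc
      calc |y (n + 3)| = |(y (n + 3) - θ / (1 + α) * y (n + 2)) + θ / (1 + α) * y (n + 2)| := by
            rw [sub_add_cancel]
        _ ≤ |y (n + 3) - θ / (1 + α) * y (n + 2)| + |θ / (1 + α) * y (n + 2)| := abs_add_le _ _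
        _ ≤ (1 - θ / (1 + α)) * K + θ / (1 + α) * K := by
            rw [abs_mul, abs_of_nonneg hc]
            exact add_le_add hstep h2
        _ = K := by ring

/-- The first value of the scheme is a convex combination of `0` and `y₀`. -/
lemma exists_first_step_eq {ν α t y0 y1 y2 : ℝ} (hν0 : 0 < ν) (hν1 : ν < 1) (hα : 0 < α)
    (ht0 : 0 < t) (ht : t ≤ 2)
    (h1 : (2 * (1 - ν) + (ν + 2) * α / t) * y1 + ν / 2 * y2 = (4 - 3 * ν) / 2 * y0)
    (h2 : (1 + α) * y2 = 2 * theta ν * y1 + (1 - 2 * theta ν) * y0) :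
    ∃ r, 0 ≤ r ∧ r ≤ 1 ∧ y1 = r * y0 := by
  obtain ⟨q, hq⟩ : ∃ q, q = 1 / (1 + α) := ⟨_, rfl⟩
  have hq0 : 0 < q := by rw [hq]; positivity
  have hqα : q * (1 + α) = 1 := by rw [hq]; field_simp
  have hq1 : q ≤ 1 := by nlinarith
  have hy2 : y2 = q * (2 * theta ν * y1 + (1 - 2 * theta ν) * y0) := by
    rw [← h2, ← mul_assoc, hqα, one_mul]
  have hθ0 := theta_nonneg hν0
  have hθ1 := theta_le hν0 hν1
  have hl : (ν + 2) / 2 * α ≤ (ν + 2) * α / t := by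
    rw [le_div_iff₀ ht0]
    nlinarith [mul_pos (by linarith : 0 < ν + 2) hα]
  set l := (ν + 2) * α / t
  have hl0 : 0 < l := lt_of_lt_of_le (by positivity) hl
  have hνq : 0 ≤ ν * q * theta ν := by positivity
  have hden : 0 < 2 * (1 - ν) + l + ν * q * theta ν := by linarith
  refine ⟨((4 - 3 * ν) / 2 - ν / 2 * (1 - 2 * theta ν) * q)
    / (2 * (1 - ν) + l + ν * q * theta ν), div_nonneg ?_ hden.le, ?_, ?_⟩
  · nlinarith [mul_le_mul_of_nonneg_left hq1 hν0.le]
  · rw [div_le_one hden]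
    have : 1 - q ≤ α := by nlinarith
    nlinarith [mul_le_mul_of_nonneg_left this hν0.le]
  · rw [div_mul_eq_mul_div, eq_div_iff hden.ne']
    rw [hy2] at h1
    linear_combination h1

lemma second_step_abs_le {θ α y0 y1 y2 r : ℝ} (hθ0 : 0 ≤ θ) (hθ1 : θ ≤ 2 / 3) (hα : 0 < α)
    (hr0 : 0 ≤ r) (hr1 : r ≤ 1) (hy1 : y1 = r * y0)
    (h2 : (1 + α) * y2 = 2 * θ * y1 + (1 - 2 * θ) * y0) :
    |y2 - θ / (1 + α) * y1| ≤ (1 - θ / (1 + α)) * |y0| := by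
  obtain ⟨q, hq⟩ : ∃ q, q = 1 / (1 + α) := ⟨_, rfl⟩
  have hq0 : 0 < q := by rw [hq]; positivity
  have hqα : q * (1 + α) = 1 := by rw [hq]; field_simp
  have hq1 : q ≤ 1 := by nlinarith
  have hθq : θ / (1 + α) = θ * q := by rw [hq]; ring
  have hy2 : y2 = q * (2 * θ * y1 + (1 - 2 * θ) * y0) := by
    rw [← h2, ← mul_assoc, hqα, one_mul]
  have e : y2 - θ / (1 + α) * y1 = q * (θ * r + 1 - 2 * θ) * y0 := by
    rw [hy2, hθq, hy1]
    ring
  rw [e, abs_mul, hθq]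
  refine mul_le_mul_of_nonneg_right (abs_le.2 ⟨?_, ?_⟩) (abs_nonneg _)
  · have : 0 ≤ q * (θ * r) := by positivity
    nlinarith
  · have := mul_le_mul_of_nonneg_left hr1 hθ0
    nlinarith

theorem stmt9 (ν lam Δx : ℝ) (hν : ν ∈ Set.Ioo (0:ℝ) 1) (hlam : 0 < lam) (hΔx : 0 < Δx)
    (y : ℕ → ℝ)
    (h1 : Δx ^ (-ν) * (Dhat0 ν * y 0 + Dhat1 ν * y 1 + Dhat2 ν * y 2) = -lam * y 1)
    (h2 : Δx ^ (-ν) * (Dtil0 ν * y 0 + Dtil1 ν * y 1 + Dtil2 ν * y 2) = -lam * y 2)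
    (h3 : ∀ j : ℕ, 3 ≤ j →
      (1 + lam * Δx ^ ν / alpha0 ν) * y j = ∑ k ∈ Finset.range j, dco ν j k * y k) :
    ∀ k : ℕ, 1 ≤ k → |y k| ≤ ((2 + ν) / (2 - ν)) * |y 0| := by
  obtain ⟨hν0, hν1⟩ := hν
  have hΓ := Gamma_three_sub_pos hν1
  have hα0 := alpha0_pos hν0 hν1
  have hX : 0 < Δx ^ ν := by positivity
  have ht0 : (0 : ℝ) < 2 ^ ν := by positivity
  have ht : (2 : ℝ) ^ ν ≤ 2 := by
    simpa using Real.rpow_le_rpow_of_exponent_le (by norm_num : (1 : ℝ) ≤ 2) hν1.le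
  obtain ⟨α, hα⟩ : ∃ α, α = lam * Δx ^ ν / alpha0 ν := ⟨_, rfl⟩
  have hαpos : 0 < α := by rw [hα]; positivity
  have hlamX : lam * Δx ^ ν = α * ((ν + 2) / ((2 : ℝ) ^ ν * Real.Gamma (3 - ν))) := by
    rw [hα, ← alpha0, div_mul_cancel₀ _ hα0.ne']
  simp only [← hα] at h3
  have hcancel (a b : ℝ) (h : Δx ^ (-ν) * a = -lam * b) : a = -(lam * Δx ^ ν) * b := by
    rw [Real.rpow_neg hΔx.le, inv_mul_eq_iff_eq_mul₀ hX.ne'] at h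
    rw [h]
    ring
  have g1 := hcancel _ _ h1
  have g2 := hcancel _ _ h2
  rw [hlamX] at g1 g2
  have f1 : (2 * (1 - ν) + (ν + 2) * α / 2 ^ ν) * y 1 + ν / 2 * y 2 = (4 - 3 * ν) / 2 * y 0 := by
    simp only [Dhat0, Dhat1, Dhat2] at g1
    field_simp at g1 ⊢
    linear_combination g1
  have f2 : (1 + α) * y 2 = 2 * theta ν * y 1 + (1 - 2 * theta ν) * y 0 := by
    simp only [Dtil0, Dtil1, Dtil2] at g2
    rw [theta]
    field_simp at g2 ⊢
    linear_combination g2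
  obtain ⟨r, hr0, hr1, hy1⟩ := exists_first_step_eq hν0 hν1 hαpos ht0 ht f1 f2
  have hθ0 := theta_nonneg hν0
  have hz := second_step_abs_le hθ0 (theta_le hν0 hν1) hαpos hr0 hr1 hy1 f2
  have hy1' : |y 1| ≤ |y 0| := by
    rw [hy1, abs_mul, abs_of_nonneg hr0]
    exact mul_le_of_le_one_left (abs_nonneg _) hr1
  have hy2' : |y 2| ≤ |y 0| := by
    have hc : 0 ≤ theta ν / (1 + α) := by positivity
    have h4 := abs_add_le (y 2 - theta ν / (1 + α) * y 1) (theta ν / (1 + α) * y 1)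
    rw [sub_add_cancel, abs_mul, abs_of_nonneg hc] at h4
    linarith [mul_le_mul_of_nonneg_left hy1' hc]
  have hstable (n : ℕ) : StableCoeffs (theta ν) (dco ν (n + 3)) n := by
    obtain ⟨i, rfl | rfl⟩ := Nat.even_or_odd' n
    · cases i with
      | zero => exact stableCoeffs_three hν0 hν1
      | succ i => exact stableCoeffs_odd hν0 hν1 i
    · exact stableCoeffs_even hν0 hν1 i
  intro k _
  have hk : |y k| ≤ |y 0| := by
    refine abs_le_of_stableCoeffs hθ0 hαpos hstable (fun k hk => ?_) hz
      (fun n => h3 (n + 3) (by omega)) k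
    interval_cases k
    exacts [le_rfl, hy1', hy2']
  refine hk.trans (le_mul_of_one_le_left (abs_nonneg _) ?_)
  rw [one_le_div (by linarith)]
  linarith
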